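/- (Optimal C^{1,1} regularity.) Let Ω ⊆ ℝⁿ be open, let φ : Ω → ℝ be differentiable with ∇φ Lipschitz on Ω (φ ∈ C^{1,1} with ‖D²φ‖_{L^∞(Ω)} finite), and let v : Ω → ℝ be continuous with v ≥ 0 such that the function u := v + φ satisfies: ∫_Ω u Δψ dx ≤ 0 for every nonnegative ψ ∈ C_c^∞(Ω) (u superharmonic distributionally), and ∫_Ω u Δψ dx = 0 for every ψ ∈ C_c^∞({v>0} ∩ Ω) (u harmonic where v > 0). Then v ∈ C^{1,1}_loc(Ω): v is differentiable on Ω and ∇v is Lipschitz on every compact subset of Ω. -/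

import Mathlib

open MeasureTheory Filter Metric Set
open scoped NNReal ENNReal Topology

noncomputable section

/-- The Laplacian of a (smooth) function, as the sum of the pure second
partial derivatives in the coordinate directions. -/
def lapSmooth {n : ℕ} (ψ : EuclideanSpace ℝ (Fin n) → ℝ)
    (x : EuclideanSpace ℝ (Fin n)) : ℝ :=
  ∑ i : Fin n,
    fderiv ℝ (fun y => fderiv ℝ ψ y (EuclideanSpace.single i 1)) x
      (EuclideanSpace.single i 1)

/-- The radial profile of the averaging kernel. -/
def obsH (t : ℝ) : ℝ := Real.smoothTransition (2 * (1 - t))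

/-- A primitive of the profile. -/
def obsP (t : ℝ) : ℝ := (1 / 2) * ∫ s in t..1, obsH s

lemma obsH_contDiff : ContDiff ℝ (⊤ : ℕ∞) obsH :=
  Real.smoothTransition.contDiff.comp (by fun_prop)

lemma obsH_nonneg (t : ℝ) : 0 ≤ obsH t := Real.smoothTransition.nonneg _
lemma obsH_le_one (t : ℝ) : obsH t ≤ 1 := Real.smoothTransition.le_one _
lemma obsH_zero {t : ℝ} (ht : 1 ≤ t) : obsH t = 0 :=
  Real.smoothTransition.zero_of_nonpos (by linarith)
lemma obsH_one {t : ℝ} (ht : t ≤ 1 / 2) : obsH t = 1 :=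
  Real.smoothTransition.one_of_one_le (by linarith)

lemma obsP_hasDerivAt (t : ℝ) : HasDerivAt obsP (-(1 / 2) * obsH t) t := by
  have hc := obsH_contDiff.continuous
  have h := intervalIntegral.integral_hasDerivAt_left (f := obsH) (a := t) (b := 1)
    (hc.intervalIntegrable _ _) (hc.stronglyMeasurableAtFilter _ _) hc.continuousAt
  have := h.const_mul (1 / 2 : ℝ)
  exact this.congr_deriv (by ring)

lemma obsP_contDiff : ContDiff ℝ (⊤ : ℕ∞) obsP := by
  rw [contDiff_infty_iff_deriv]
  refine ⟨fun t => (obsP_hasDerivAt t).differentiableAt, ?_⟩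
  have : deriv obsP = fun t => -(1 / 2) * obsH t := funext fun t => (obsP_hasDerivAt t).deriv
  rw [this]
  exact contDiff_const.mul obsH_contDiff

lemma obsP_zero {t : ℝ} (ht : 1 ≤ t) : obsP t = 0 := by
  unfold obsP
  rw [intervalIntegral.integral_symm, intervalIntegral.integral_zero_ae]
  · simp
  · filter_upwards with x hx
    rw [uIoc_of_le ht] at hx
    exact obsH_zero hx.1.le

lemma obsP_nonneg (t : ℝ) : 0 ≤ obsP t := by
  rcases le_total 1 t with h | h
  · rw [obsP_zero h]
  · unfold obsP
    have := intervalIntegral.integral_nonneg (μ := volume) h (fun u _ => obsH_nonneg u)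
    positivity

/-- The test function. -/
def obsPsi {n : ℕ} (x : EuclideanSpace ℝ (Fin n)) (r : ℝ) (y : EuclideanSpace ℝ (Fin n)) : ℝ :=
  obsP (‖y - x‖ ^ 2 / r ^ 2)

/-- The averaging kernel. -/
def obsK {n : ℕ} (x : EuclideanSpace ℝ (Fin n)) (r : ℝ) (y : EuclideanSpace ℝ (Fin n)) : ℝ :=
  (r ^ n)⁻¹ * obsH (‖y - x‖ ^ 2 / r ^ 2)

lemma obsPsi_contDiff {n : ℕ} (x : EuclideanSpace ℝ (Fin n)) (r : ℝ) :
    ContDiff ℝ (⊤ : ℕ∞) (obsPsi x r) := by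
  unfold obsPsi
  refine obsP_contDiff.comp ?_
  exact ((contDiff_id.sub contDiff_const).norm_sq ℝ).div_const _

lemma obs_one_le {n : ℕ} {x y : EuclideanSpace ℝ (Fin n)} {r : ℝ} (hr : 0 < r)
    (hy : y ∉ ball x r) : 1 ≤ ‖y - x‖ ^ 2 / r ^ 2 := by
  rw [mem_ball, dist_eq_norm, not_lt] at hy
  rw [le_div_iff₀ (by positivity), one_mul]
  gcongr

lemma obsPsi_tsupport {n : ℕ} (x : EuclideanSpace ℝ (Fin n)) {r : ℝ} (hr : 0 < r) :
    tsupport (obsPsi x r) ⊆ closedBall x r := by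
  refine closure_minimal ?_ isClosed_closedBall
  intro y hy
  by_contra h
  exact hy (obsP_zero (obs_one_le hr (fun h' => h (ball_subset_closedBall h'))))

lemma obsPsi_compact {n : ℕ} (x : EuclideanSpace ℝ (Fin n)) {r : ℝ} (hr : 0 < r) :
    HasCompactSupport (obsPsi x r) :=
  (isCompact_closedBall x r).of_isClosed_subset (isClosed_tsupport _) (obsPsi_tsupport x hr)

/-- The radial profile of the Laplacian of the test function. -/
def obsG (n : ℕ) (q : ℝ) : ℝ := -(n * obsH q + 2 * q * deriv obsH q)

lemma obsH_hasDerivAt (t : ℝ) : HasDerivAt obsH (deriv obsH t) t :=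
  ((obsH_contDiff.differentiable (by simp)) t).hasDerivAt

lemma obs_q_hasFDerivAt {n : ℕ} (x : EuclideanSpace ℝ (Fin n)) (r : ℝ)
    (y : EuclideanSpace ℝ (Fin n)) :
    HasFDerivAt (fun y => ‖y - x‖ ^ 2 / r ^ 2)
      ((r ^ 2)⁻¹ • (2 • (innerSL ℝ (y - x)))) y := by
  have h := ((hasFDerivAt_id y).sub_const x).norm_sq
  have h2 := h.mul_const ((r ^ 2)⁻¹)
  exact h2.congr_fderiv (by ext; simp)

lemma obsPsi_lap {n : ℕ} (x : EuclideanSpace ℝ (Fin n)) (r : ℝ)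
    (y : EuclideanSpace ℝ (Fin n)) :
    lapSmooth (obsPsi x r) y = (r ^ 2)⁻¹ * obsG n (‖y - x‖ ^ 2 / r ^ 2) := by
  unfold lapSmooth
  have h1 : ∀ i : Fin n, (fun y => fderiv ℝ (obsPsi x r) y (EuclideanSpace.single i 1)) =
      fun y => -(r ^ 2)⁻¹ * (obsH (‖y - x‖ ^ 2 / r ^ 2) * (y i - x i)) := by
    intro i
    funext y
    have h := (obsP_hasDerivAt (‖y - x‖ ^ 2 / r ^ 2)).comp_hasFDerivAt y (obs_q_hasFDerivAt x r y)
    have h' : HasFDerivAt (obsPsi x r) _ y := h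
    rw [h'.fderiv]
    simp [EuclideanSpace.inner_single_right]
    ring
  have h2 : ∀ i : Fin n, fderiv ℝ (fun y => fderiv ℝ (obsPsi x r) y (EuclideanSpace.single i 1)) y
      (EuclideanSpace.single i 1) = -(r ^ 2)⁻¹ * (obsH (‖y - x‖ ^ 2 / r ^ 2) +
        deriv obsH (‖y - x‖ ^ 2 / r ^ 2) * (2 * (y i - x i) ^ 2 / r ^ 2)) := by
    intro i
    rw [h1 i]
    have h := (obsH_hasDerivAt (‖y - x‖ ^ 2 / r ^ 2)).comp_hasFDerivAt y (obs_q_hasFDerivAt x r y)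
    have hp : HasFDerivAt (fun y : EuclideanSpace ℝ (Fin n) => y i - x i)
        (EuclideanSpace.proj i : EuclideanSpace ℝ (Fin n) →L[ℝ] ℝ) y :=
      (EuclideanSpace.proj i : EuclideanSpace ℝ (Fin n) →L[ℝ] ℝ).hasFDerivAt.sub_const _
    have h3 := (h.mul hp).const_mul (-(r ^ 2)⁻¹)
    have h4 : HasFDerivAt (fun y => -(r ^ 2)⁻¹ * (obsH (‖y - x‖ ^ 2 / r ^ 2) * (y i - x i))) _ y := h3
    rw [h4.fderiv]
    simp [EuclideanSpace.inner_single_right]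
    ring
  rw [Finset.sum_congr rfl (fun i _ => h2 i), ← Finset.mul_sum, Finset.sum_add_distrib,
    ← Finset.mul_sum, ← Finset.sum_div, ← Finset.mul_sum]
  have h5 : ∑ i, (y i - x i) ^ 2 = ‖y - x‖ ^ 2 := by
    rw [EuclideanSpace.norm_sq_eq]; simp
  rw [h5]
  simp [obsG]
  ring

lemma obsK_hasDerivAt {n : ℕ} (x : EuclideanSpace ℝ (Fin n)) {r : ℝ} (hr : 0 < r)
    (y : EuclideanSpace ℝ (Fin n)) :
    HasDerivAt (fun r => obsK x r y) ((r ^ (n + 1))⁻¹ * obsG n (‖y - x‖ ^ 2 / r ^ 2)) r := by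
  unfold obsK
  have hq : HasDerivAt (fun r : ℝ => ‖y - x‖ ^ 2 / r ^ 2) (-2 * ‖y - x‖ ^ 2 / r ^ 3) r := by
    have := ((hasDerivAt_pow 2 r).inv (by positivity)).const_mul (‖y - x‖ ^ 2)
    refine this.congr_deriv ?_
    field_simp
    simp
    ring
  have h1 := (obsH_hasDerivAt (‖y - x‖ ^ 2 / r ^ 2)).comp r hq
  have h2 := ((hasDerivAt_pow n r).inv (by positivity)).mul h1
  refine h2.congr_deriv ?_
  simp only [obsG, Function.comp, Pi.inv_apply]
  rcases n with _ | m
  · simp; field_simp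
  · simp; field_simp; ring

/-- The total mass of the kernel. -/
def obsC (n : ℕ) : ℝ := ∫ z : EuclideanSpace ℝ (Fin n), obsH (‖z‖ ^ 2)

lemma obsK_nonneg {n : ℕ} (x : EuclideanSpace ℝ (Fin n)) {r : ℝ} (hr : 0 < r)
    (y : EuclideanSpace ℝ (Fin n)) : 0 ≤ obsK x r y :=
  mul_nonneg (by positivity) (obsH_nonneg _)

lemma obsK_zero {n : ℕ} {x y : EuclideanSpace ℝ (Fin n)} {r : ℝ} (hr : 0 < r)
    (hy : y ∉ ball x r) : obsK x r y = 0 := by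
  unfold obsK
  rw [obsH_zero (obs_one_le hr hy), mul_zero]

lemma obsK_continuous {n : ℕ} (x : EuclideanSpace ℝ (Fin n)) (r : ℝ) : Continuous (obsK x r) := by
  unfold obsK
  have := obsH_contDiff.continuous
  fun_prop

lemma obsG_continuous (n : ℕ) : Continuous (obsG n) := by
  unfold obsG
  have := obsH_contDiff.continuous
  have := obsH_contDiff.continuous_deriv (by simp)
  fun_prop

lemma obsEta_hasCompactSupport (n : ℕ) :
    HasCompactSupport (fun z : EuclideanSpace ℝ (Fin n) => obsH (‖z‖ ^ 2)) := by
  refine HasCompactSupport.intro (isCompact_closedBall 0 1) ?_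
  intro z hz
  rw [mem_closedBall_zero_iff, not_le] at hz
  exact obsH_zero (by nlinarith)

lemma obsEta_contDiff (n : ℕ) :
    ContDiff ℝ (⊤ : ℕ∞) (fun z : EuclideanSpace ℝ (Fin n) => obsH (‖z‖ ^ 2)) :=
  obsH_contDiff.comp (contDiff_norm_sq ℝ)

lemma obsC_pos (n : ℕ) : 0 < obsC n := by
  refine Continuous.integral_pos_of_hasCompactSupport_nonneg_nonzero (x := 0)
    (obsEta_contDiff n).continuous (obsEta_hasCompactSupport n) (fun z => obsH_nonneg _) ?_
  simp [obsH_one]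

lemma obsK_eq {n : ℕ} (x : EuclideanSpace ℝ (Fin n)) {r : ℝ} (hr : 0 < r)
    (y : EuclideanSpace ℝ (Fin n)) : obsK x r y = (r ^ n)⁻¹ * obsH (‖r⁻¹ • (y - x)‖ ^ 2) := by
  unfold obsK
  rw [norm_smul, mul_pow, norm_inv, Real.norm_of_nonneg hr.le, inv_pow]
  congr 2
  ring

lemma obsK_integral {n : ℕ} (x : EuclideanSpace ℝ (Fin n)) {r : ℝ} (hr : 0 < r) :
    ∫ y, obsK x r y = obsC n := by
  simp_rw [obsK_eq x hr]
  rw [integral_const_mul,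
    integral_sub_right_eq_self (fun z : EuclideanSpace ℝ (Fin n) => obsH (‖r⁻¹ • z‖ ^ 2)) x,
    Measure.integral_comp_inv_smul_of_nonneg volume
      (fun z : EuclideanSpace ℝ (Fin n) => obsH (‖z‖ ^ 2)) hr.le]
  simp only [finrank_euclideanSpace, Fintype.card_fin, smul_eq_mul]
  rw [← mul_assoc, inv_mul_cancel₀ (by positivity), one_mul, obsC]

lemma obsK_setIntegral {n : ℕ} (x : EuclideanSpace ℝ (Fin n)) {r : ℝ} (hr : 0 < r)
    {S : Set (EuclideanSpace ℝ (Fin n))} (hS : ball x r ⊆ S)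
    (f : EuclideanSpace ℝ (Fin n) → ℝ) :
    ∫ y in S, f y * obsK x r y = ∫ y, f y * obsK x r y := by
  refine setIntegral_eq_integral_of_forall_compl_eq_zero fun y hy => ?_
  rw [obsK_zero hr (fun h => hy (hS h)), mul_zero]

lemma obsK_setIntegral' {n : ℕ} (x : EuclideanSpace ℝ (Fin n)) {r : ℝ} (hr : 0 < r)
    {S : Set (EuclideanSpace ℝ (Fin n))} (hS : ball x r ⊆ S) :
    ∫ y in S, obsK x r y = obsC n := by
  have := obsK_setIntegral x hr hS (fun _ => 1)
  simpa [obsK_integral x hr] using this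

lemma obsG_zero (n : ℕ) {q : ℝ} (hq : 1 ≤ q) : obsG n q = 0 := by
  have hd : Set.EqOn (deriv obsH) 0 (Ici 1) := by
    have h1 : Set.EqOn (deriv obsH) 0 (Ioi 1) := by
      intro t ht
      have : obsH =ᶠ[𝓝 t] fun _ => 0 := by
        filter_upwards [Ioi_mem_nhds ht] with s hs using obsH_zero (le_of_lt hs)
      rw [this.deriv_eq]; simp
    have := h1.closure (obsH_contDiff.continuous_deriv (by simp)) continuous_zero
    rwa [closure_Ioi] at this
  have := hd hq
  simp only [obsG, obsH_zero hq, this, Pi.zero_apply]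
  ring

lemma obsG_bound (n : ℕ) : ∃ B : ℝ, 0 ≤ B ∧ ∀ q, 0 ≤ q → |obsG n q| ≤ B := by
  obtain ⟨B, hB⟩ := (isCompact_Icc (a := (0 : ℝ)) (b := 1)).exists_bound_of_continuousOn
    (obsG_continuous n).continuousOn
  refine ⟨B, (norm_nonneg _).trans (hB 0 (by simp)), fun q hq => ?_⟩
  rcases le_total q 1 with h | h
  · exact hB q ⟨hq, h⟩
  · rw [obsG_zero n h, abs_zero]
    exact (norm_nonneg _).trans (hB 0 (by simp))

lemma obs_M_hasDerivAt {n : ℕ} {x : EuclideanSpace ℝ (Fin n)} {R : ℝ}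
    {f : EuclideanSpace ℝ (Fin n) → ℝ} (hf : ContinuousOn f (closedBall x R))
    {r : ℝ} (hr : 0 < r) :
    HasDerivAt (fun r => ∫ y in closedBall x R, f y * obsK x r y)
      (∫ y in closedBall x R, f y * ((r ^ (n + 1))⁻¹ * obsG n (‖y - x‖ ^ 2 / r ^ 2))) r := by
  obtain ⟨A, hA⟩ := (isCompact_closedBall x R).exists_bound_of_continuousOn hf
  obtain ⟨B, hB0, hB⟩ := obsG_bound n
  have hcK : ∀ r, ContinuousOn (fun y => f y * obsK x r y) (closedBall x R) := fun r =>
    hf.mul (obsK_continuous x r).continuousOn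
  have hcG : ContinuousOn (fun y => f y * ((r ^ (n + 1))⁻¹ * obsG n (‖y - x‖ ^ 2 / r ^ 2)))
      (closedBall x R) := by
    refine hf.mul (Continuous.continuousOn ?_)
    have := obsG_continuous n
    fun_prop
  refine (hasDerivAt_integral_of_dominated_loc_of_deriv_le
    (F := fun r y => f y * obsK x r y)
    (F' := fun r y => f y * ((r ^ (n + 1))⁻¹ * obsG n (‖y - x‖ ^ 2 / r ^ 2)))
    (s := Ioi (r / 2)) (bound := fun _ => A * (((r / 2) ^ (n + 1))⁻¹ * B))
    (Ioi_mem_nhds (by linarith)) ?_ ?_ ?_ ?_ ?_ ?_).2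
  · filter_upwards with s
    exact (hcK s).aestronglyMeasurable measurableSet_closedBall
  · exact (hcK r).integrableOn_compact (isCompact_closedBall x R)
  · exact hcG.aestronglyMeasurable measurableSet_closedBall
  · filter_upwards [ae_restrict_mem measurableSet_closedBall] with y hy s hs
    have hs' : r / 2 < s := hs
    have hs0 : 0 < s := by linarith
    rw [norm_mul, norm_mul]
    have h1 := hA y hy
    have h2 := hB (‖y - x‖ ^ 2 / s ^ 2) (by positivity)
    have h3 : ‖(s ^ (n + 1))⁻¹‖ ≤ ((r / 2) ^ (n + 1))⁻¹ := by
      rw [Real.norm_of_nonneg (by positivity)]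
      gcongr
    have h4 : 0 ≤ A := (norm_nonneg _).trans h1
    rw [← Real.norm_eq_abs] at h2
    gcongr
  · exact continuousOn_const.integrableOn_compact (isCompact_closedBall x R)
  · filter_upwards with y s hs
    have hs' : r / 2 < s := hs
    exact (obsK_hasDerivAt x (by linarith) y).const_mul _

lemma obs_mean_le {n : ℕ} {x : EuclideanSpace ℝ (Fin n)} {R : ℝ}
    {f : EuclideanSpace ℝ (Fin n) → ℝ} (hf : ContinuousOn f (closedBall x R))
    (hlap : ∀ r ∈ Ioo 0 R, ∫ y in closedBall x R, f y * lapSmooth (obsPsi x r) y ≤ 0)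
    {r : ℝ} (hr : r ∈ Ioo 0 R) :
    ∫ y, f y * obsK x r y ≤ obsC n * f x := by
  have hR : 0 < R := hr.1.trans hr.2
  have hanti : AntitoneOn (fun r => ∫ y in closedBall x R, f y * obsK x r y) (Ioo 0 R) := by
    refine antitoneOn_of_deriv_nonpos (convex_Ioo 0 R)
      (fun s hs => (obs_M_hasDerivAt hf hs.1).continuousAt.continuousWithinAt) ?_ ?_
    · rw [interior_Ioo]
      exact fun s hs => (obs_M_hasDerivAt hf hs.1).differentiableAt.differentiableWithinAt
    · rw [interior_Ioo]
      intro s hs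
      have hs0 : 0 < s := hs.1
      rw [(obs_M_hasDerivAt hf hs.1).deriv]
      have h := hlap s hs
      simp_rw [obsPsi_lap] at h
      have : ∀ y, f y * ((s ^ (n + 1))⁻¹ * obsG n (‖y - x‖ ^ 2 / s ^ 2)) =
          ((s ^ (n + 1))⁻¹ * s ^ 2) * (f y * ((s ^ 2)⁻¹ * obsG n (‖y - x‖ ^ 2 / s ^ 2))) := by
        intro y; field_simp
      simp_rw [this]
      rw [integral_const_mul]
      exact mul_nonpos_of_nonneg_of_nonpos (by positivity) h
  rw [← obsK_setIntegral x hr.1 ((ball_subset_ball hr.2.le).trans ball_subset_closedBall)]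
  have hC := obsC_pos n
  refine le_of_forall_pos_le_add fun ε hε => ?_
  have hcx := hf x (mem_closedBall_self hR.le)
  obtain ⟨δ, hδ, hδf⟩ := Metric.continuousWithinAt_iff.1 hcx (ε / obsC n) (by positivity)
  set s := min r (δ / 2) with hs
  have hs0 : 0 < s := lt_min hr.1 (by linarith)
  have hsr : s ≤ r := min_le_left _ _
  have hsδ : s < δ := (min_le_right _ _).trans_lt (by linarith)
  have hsub : ball x s ⊆ closedBall x R :=
    (ball_subset_ball (hsr.trans hr.2.le)).trans ball_subset_closedBall
  have h1 := hanti ⟨hs0, hsr.trans_lt hr.2⟩ hr hsr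
  refine h1.trans ?_
  have h2 : ∫ y in closedBall x R, f y * obsK x s y ≤
      ∫ y in closedBall x R, (f x + ε / obsC n) * obsK x s y := by
    refine setIntegral_mono_on
      ((hf.mul (obsK_continuous x s).continuousOn).integrableOn_compact (isCompact_closedBall x R))
      ((continuousOn_const.mul (obsK_continuous x s).continuousOn).integrableOn_compact
        (isCompact_closedBall x R)) measurableSet_closedBall ?_
    intro y hy
    by_cases hys : y ∈ ball x s
    · have h3 := hδf hy (lt_trans hys hsδ)
      rw [Real.dist_eq] at h3
      have h4 := (abs_lt.1 h3).2
      exact mul_le_mul_of_nonneg_right (by linarith) (obsK_nonneg x hs0 y)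
    · rw [obsK_zero hs0 hys]; simp
  refine h2.trans (le_of_eq ?_)
  rw [integral_const_mul, obsK_setIntegral' x hs0 hsub]
  field_simp

lemma obs_mean_eq {n : ℕ} {x : EuclideanSpace ℝ (Fin n)} {R : ℝ}
    {f : EuclideanSpace ℝ (Fin n) → ℝ} (hf : ContinuousOn f (closedBall x R))
    (hlap : ∀ r ∈ Ioo 0 R, ∫ y in closedBall x R, f y * lapSmooth (obsPsi x r) y = 0)
    {r : ℝ} (hr : r ∈ Ioo 0 R) :
    ∫ y, f y * obsK x r y = obsC n * f x := by
  refine le_antisymm (obs_mean_le hf (fun r hr => (hlap r hr).le) hr) ?_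
  have := obs_mean_le hf.neg (fun r hr => by
    simp only [Pi.neg_apply, neg_mul]
    rw [integral_neg, hlap r hr, neg_zero]) hr
  simp only [Pi.neg_apply, neg_mul, mul_neg] at this
  rw [integral_neg] at this
  linarith

/-- Affine functions are reproduced by the kernel. -/
lemma obs_mean_affine {n : ℕ} (x : EuclideanSpace ℝ (Fin n)) {r : ℝ} (hr : 0 < r)
    (p : EuclideanSpace ℝ (Fin n) →L[ℝ] ℝ) (c : ℝ) :
    ∫ y, (c + p y) * obsK x r y = obsC n * (c + p x) := by
  have h0 : ∫ z : EuclideanSpace ℝ (Fin n), p z * obsK 0 r z = 0 := by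
    have h := integral_neg_eq_self (fun z : EuclideanSpace ℝ (Fin n) => p z * obsK 0 r z) volume
    have h' : ∀ z : EuclideanSpace ℝ (Fin n), p (-z) * obsK 0 r (-z) = -(p z * obsK 0 r z) := by
      intro z
      simp [obsK]
    simp_rw [h'] at h
    rw [integral_neg] at h
    linarith
  have h1 : ∫ y, p (y - x) * obsK x r y = 0 := by
    have h := integral_sub_right_eq_self
      (fun z : EuclideanSpace ℝ (Fin n) => p z * obsK 0 r z) (μ := volume) x
    rw [h0] at h
    simpa [obsK] using h
  have hcs : HasCompactSupport (obsK x r) := by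
    refine HasCompactSupport.intro (isCompact_closedBall x r) fun y hy => ?_
    exact obsK_zero hr (fun h => hy (ball_subset_closedBall h))
  have hi1 : Integrable (fun y => p (y - x) * obsK x r y) := by
    refine Continuous.integrable_of_hasCompactSupport ?_ hcs.mul_left
    have := obsK_continuous x r
    fun_prop
  have hi2 : Integrable (fun y => (c + p x) * obsK x r y) := by
    refine Continuous.integrable_of_hasCompactSupport ?_ hcs.mul_left
    have := obsK_continuous x r
    fun_prop
  have : ∀ y, (c + p y) * obsK x r y = p (y - x) * obsK x r y + (c + p x) * obsK x r y := by
    intro y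
    rw [map_sub]; ring
  simp_rw [this]
  rw [integral_add hi1 hi2, h1, integral_const_mul, obsK_integral x hr]
  ring

lemma obs_taylor {E : Type*} [NormedAddCommGroup E] [NormedSpace ℝ E] {f : E → ℝ} {x y : E}
    {L : ℝ} (hL : 0 ≤ L)
    (hd : ∀ z ∈ closedBall x ‖y - x‖, DifferentiableAt ℝ f z)
    (hlip : ∀ z ∈ closedBall x ‖y - x‖, ‖fderiv ℝ f z - fderiv ℝ f x‖ ≤ L * ‖z - x‖) :
    |f y - f x - fderiv ℝ f x (y - x)| ≤ L * ‖y - x‖ ^ 2 := by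
  have h := (convex_closedBall x ‖y - x‖).norm_image_sub_le_of_norm_hasFDerivWithin_le'
    (f := f) (f' := fderiv ℝ f) (φ := fderiv ℝ f x) (C := L * ‖y - x‖)
    (fun z hz => (hd z hz).hasFDerivAt.hasFDerivWithinAt)
    (fun z hz => (hlip z hz).trans (by
      have : ‖z - x‖ ≤ ‖y - x‖ := by rwa [mem_closedBall, dist_eq_norm] at hz
      gcongr))
    (mem_closedBall_self (norm_nonneg _)) (y := y) (by rw [mem_closedBall, dist_eq_norm])
  rw [Real.norm_eq_abs] at h
  calc _ ≤ _ := h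
    _ = _ := by ring

lemma obs_integrable {n : ℕ} {x : EuclideanSpace ℝ (Fin n)} {r : ℝ} (hr : 0 < r)
    {f : EuclideanSpace ℝ (Fin n) → ℝ} (hf : ContinuousOn f (closedBall x r)) :
    Integrable (fun y => f y * obsK x r y) := by
  have h : IntegrableOn (fun y => f y * obsK x r y) (closedBall x r) :=
    (hf.mul (obsK_continuous x r).continuousOn).integrableOn_compact (isCompact_closedBall x r)
  refine h.integrable_of_forall_notMem_eq_zero fun y hy => ?_
  rw [obsK_zero hr (fun h => hy (ball_subset_closedBall h)), mul_zero]

lemma obs_mean_sub_affine {n : ℕ} {x : EuclideanSpace ℝ (Fin n)} {r : ℝ} (hr : 0 < r)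
    {f : EuclideanSpace ℝ (Fin n) → ℝ} (hf : ContinuousOn f (closedBall x r))
    (p : EuclideanSpace ℝ (Fin n) →L[ℝ] ℝ) (c : ℝ) :
    ∫ y, (f y - (c + p y)) * obsK x r y =
      (∫ y, f y * obsK x r y) - obsC n * (c + p x) := by
  have h2 : Integrable (fun y => (c + p y) * obsK x r y) :=
    obs_integrable hr (by fun_prop)
  simp_rw [sub_mul]
  rw [integral_sub (obs_integrable hr hf) h2, obs_mean_affine x hr p c]

lemma obsK_compare {n : ℕ} {x x0 : EuclideanSpace ℝ (Fin n)} {d : ℝ} (hd : 0 < d)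
    (hx : ‖x - x0‖ ≤ d) (y : EuclideanSpace ℝ (Fin n)) :
    obsK x (d / 2) y ≤ 6 ^ n * obsK x0 (3 * d) y := by
  by_cases hy : y ∈ ball x (d / 2)
  · rw [mem_ball, dist_eq_norm] at hy
    have h1 : ‖y - x0‖ ≤ 3 / 2 * d := by
      calc ‖y - x0‖ = ‖(y - x) + (x - x0)‖ := by congr 1; abel
        _ ≤ ‖y - x‖ + ‖x - x0‖ := norm_add_le _ _
        _ ≤ _ := by linarith
    have h2 : ‖y - x0‖ ^ 2 / (3 * d) ^ 2 ≤ 1 / 2 := by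
      rw [div_le_iff₀ (by positivity)]
      nlinarith [norm_nonneg (y - x0)]
    unfold obsK
    rw [obsH_one h2, mul_one]
    have h3 : ((d / 2) ^ n)⁻¹ = 6 ^ n * ((3 * d) ^ n)⁻¹ := by
      rw [← inv_pow, ← inv_pow, ← mul_pow]
      congr 1
      field_simp
      norm_num
    rw [← h3]
    exact mul_le_of_le_one_right (by positivity) (obsH_le_one _)
  · rw [obsK_zero (by positivity) hy]
    have := obsK_nonneg x0 (r := 3 * d) (by positivity) y
    positivity

lemma obs_growth {n : ℕ} {x x0 : EuclideanSpace ℝ (Fin n)} {d L : ℝ} (hd : 0 < d) (hL : 0 ≤ L)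
    (hx : ‖x - x0‖ ≤ d) {v φ : EuclideanSpace ℝ (Fin n) → ℝ}
    (hu : ContinuousOn (fun y => v y + φ y) (closedBall x0 (3 * d)))
    (hv : ∀ y ∈ closedBall x0 (3 * d), 0 ≤ v y) (hv0 : v x0 = 0)
    (hle : ∫ y, (v y + φ y) * obsK x0 (3 * d) y ≤ obsC n * (v x0 + φ x0))
    (heq : ∫ y, (v y + φ y) * obsK x (d / 2) y = obsC n * (v x + φ x))
    (p : EuclideanSpace ℝ (Fin n) →L[ℝ] ℝ)
    (hφ : ∀ y ∈ closedBall x0 (3 * d), |φ y - φ x0 - p (y - x0)| ≤ L * ‖y - x0‖ ^ 2) :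
    v x ≤ (9 * 6 ^ n * L) * d ^ 2 := by
  set c : ℝ := φ x0 - p x0 - 9 * L * d ^ 2 with hc
  have hsub : closedBall x (d / 2) ⊆ closedBall x0 (3 * d) := by
    refine closedBall_subset_closedBall' ?_
    rw [dist_eq_norm]; linarith
  have hbd : ∀ y ∈ closedBall x0 (3 * d), v y ≤ v y + φ y - (c + p y) := by
    intro y hy
    have h1 := (abs_le.1 (hφ y hy)).1
    have h2 : ‖y - x0‖ ≤ 3 * d := by rwa [mem_closedBall, dist_eq_norm] at hy
    have h3 : L * ‖y - x0‖ ^ 2 ≤ L * (3 * d) ^ 2 := by gcongr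
    rw [map_sub] at h1
    rw [hc]
    nlinarith
  have e1 := obs_mean_sub_affine (by positivity : 0 < d / 2) (hu.mono hsub) p c
  have e2 := obs_mean_sub_affine (by positivity : 0 < 3 * d) hu p c
  rw [heq] at e1
  have hmono : ∫ y, (v y + φ y - (c + p y)) * obsK x (d / 2) y ≤
      ∫ y, 6 ^ n * ((v y + φ y - (c + p y)) * obsK x0 (3 * d) y) := by
    have hcont : ContinuousOn (fun y => v y + φ y - (c + p y)) (closedBall x0 (3 * d)) :=
      hu.sub (by fun_prop)
    refine integral_mono (obs_integrable (by positivity) (hcont.mono hsub))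
      ((obs_integrable (by positivity) hcont).const_mul _) ?_
    intro y
    by_cases hy : y ∈ closedBall x0 (3 * d)
    · have h1 := hbd y hy
      have h2 := hv y hy
      have h3 := obsK_compare hd hx y
      calc _ ≤ (v y + φ y - (c + p y)) * (6 ^ n * obsK x0 (3 * d) y) :=
            mul_le_mul_of_nonneg_left h3 (by linarith)
        _ = _ := by ring
    · have h1 : y ∉ ball x (d / 2) := fun h => hy (hsub (ball_subset_closedBall h))
      have h2 : y ∉ ball x0 (3 * d) := fun h => hy (ball_subset_closedBall h)
      simp only
      rw [obsK_zero (by positivity) h1, obsK_zero (by positivity) h2]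
      simp
  rw [integral_const_mul, e1, e2] at hmono
  have hC := obsC_pos n
  have h6 : (0 : ℝ) < 6 ^ n := by positivity
  have hx' := hbd x (by
    rw [mem_closedBall, dist_eq_norm]; linarith)
  have h7 : obsC n * v x ≤ obsC n * (9 * 6 ^ n * L * d ^ 2) := by
    calc obsC n * v x ≤ obsC n * (v x + φ x - (c + p x)) := by gcongr
      _ = obsC n * (v x + φ x) - obsC n * (c + p x) := by ring
      _ ≤ 6 ^ n * ((∫ y, (v y + φ y) * obsK x0 (3 * d) y) - obsC n * (c + p x0)) := hmono
      _ ≤ 6 ^ n * (obsC n * (v x0 + φ x0) - obsC n * (c + p x0)) := by gcongr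
      _ = _ := by rw [hv0, hc]; ring
  exact le_of_mul_le_mul_left h7 hC

lemma obsEta_bounds (n : ℕ) : ∃ B : ℝ, 0 ≤ B ∧
    (∀ z : EuclideanSpace ℝ (Fin n), ‖fderiv ℝ (fun z => obsH (‖z‖ ^ 2)) z‖ ≤ B) ∧
    ∀ a b : EuclideanSpace ℝ (Fin n), |obsH (‖b‖ ^ 2) - obsH (‖a‖ ^ 2) -
      fderiv ℝ (fun z => obsH (‖z‖ ^ 2)) a (b - a)| ≤ B * ‖b - a‖ ^ 2 := by
  have hs := (obsEta_hasCompactSupport n).fderiv ℝ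
  have hc : ContDiff ℝ 1 (fderiv ℝ (fun z : EuclideanSpace ℝ (Fin n) => obsH (‖z‖ ^ 2))) :=
    (obsEta_contDiff n).fderiv_right (by norm_cast)
  obtain ⟨K, hK⟩ := hc.lipschitzWith_of_hasCompactSupport hs (by simp)
  obtain ⟨B, hB⟩ := hs.exists_bound_of_continuous hc.continuous
  refine ⟨max K B, le_max_of_le_left K.2, fun z => (hB z).trans (le_max_right _ _), ?_⟩
  intro a b
  refine (obs_taylor (f := fun z : EuclideanSpace ℝ (Fin n) => obsH (‖z‖ ^ 2)) K.2
    (fun z _ => ((obsEta_contDiff n).differentiable (by simp)) z) ?_).trans ?_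
  · intro z _
    exact hK.norm_sub_le z a
  · gcongr
    exact le_max_left _ _

lemma obs_harm_taylor (n : ℕ) : ∃ C1 : ℝ, 0 ≤ C1 ∧
    ∀ (x : EuclideanSpace ℝ (Fin n)) (r A : ℝ) (w : EuclideanSpace ℝ (Fin n) → ℝ), 0 < r →
      ContinuousOn w (closedBall x (2 * r)) → (∀ y ∈ closedBall x (2 * r), |w y| ≤ A) →
      (∀ y ∈ closedBall x r, ∫ z, w z * obsK y r z = obsC n * w y) →
      ∃ p : EuclideanSpace ℝ (Fin n) →L[ℝ] ℝ, ‖p‖ ≤ C1 * A / r ∧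
        ∀ y ∈ closedBall x r, |w y - w x - p (y - x)| ≤ C1 * A / r ^ 2 * ‖y - x‖ ^ 2 := by
  obtain ⟨B, hB0, hB1, hB2⟩ := obsEta_bounds n
  set ω : ℝ := volume.real (ball (0 : EuclideanSpace ℝ (Fin n)) 1) with hω
  have hC := obsC_pos n
  refine ⟨(obsC n)⁻¹ * (B * 2 ^ n * ω), by positivity, ?_⟩
  intro x r A w hr hw hA hmean
  set S := closedBall x (2 * r) with hS
  have hA0 : 0 ≤ A := (abs_nonneg _).trans (hA x (mem_closedBall_self (by positivity)))
  have hvol : volume.real S = 2 ^ n * r ^ n * ω := by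
    rw [hS, Measure.addHaar_real_closedBall _ _ (by positivity), finrank_euclideanSpace_fin,
      mul_pow]
  have hSfin : volume S < ∞ := measure_closedBall_lt_top
  set D : EuclideanSpace ℝ (Fin n) → (EuclideanSpace ℝ (Fin n) →L[ℝ] ℝ) :=
    fun z => (w z * ((r ^ n)⁻¹ * (-r⁻¹))) •
      fderiv ℝ (fun z : EuclideanSpace ℝ (Fin n) => obsH (‖z‖ ^ 2)) (r⁻¹ • (z - x)) with hD
  have hcD : ContinuousOn D S := by
    refine ContinuousOn.smul (hw.mul continuousOn_const) (Continuous.continuousOn ?_)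
    have := (obsEta_contDiff n).continuous_fderiv (by simp)
    fun_prop
  have hiD : IntegrableOn D S := hcD.integrableOn_compact (isCompact_closedBall _ _)
  refine ⟨(obsC n)⁻¹ • ∫ z in S, D z, ?_, ?_⟩
  · have h1 : ‖∫ z in S, D z‖ ≤ (A * ((r ^ n)⁻¹ * r⁻¹) * B) * volume.real S := by
      refine norm_setIntegral_le_of_norm_le_const hSfin ?_
      intro z hz
      rw [hD, norm_smul, norm_mul, norm_mul, norm_neg, Real.norm_of_nonneg (r := (r ^ n)⁻¹) (by positivity),
        Real.norm_of_nonneg (r := r⁻¹) (by positivity)]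
      have := hA z hz
      have h2 := hB1 (r⁻¹ • (z - x))
      rw [← Real.norm_eq_abs] at this
      gcongr
    rw [norm_smul, Real.norm_of_nonneg (by positivity)]
    calc _ ≤ (obsC n)⁻¹ * ((A * ((r ^ n)⁻¹ * r⁻¹) * B) * volume.real S) := by gcongr
      _ = _ := by rw [hvol]; field_simp
  · intro y hy
    have hyn : ‖y - x‖ ≤ r := by rwa [mem_closedBall, dist_eq_norm] at hy
    have hmS : ∀ y ∈ closedBall x r, ∫ z in S, w z * obsK y r z = obsC n * w y := by
      intro y hy
      rw [obsK_setIntegral y hr, hmean y hy]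
      refine ball_subset_closedBall.trans (closedBall_subset_closedBall' ?_)
      have := mem_closedBall.1 hy
      linarith
    have hi : ∀ y, IntegrableOn (fun z => w z * obsK y r z) S := fun y =>
      (hw.mul (obsK_continuous y r).continuousOn).integrableOn_compact (isCompact_closedBall _ _)
    have hiDy : IntegrableOn (fun z => D z (y - x)) S :=
      ((ContinuousLinearMap.apply ℝ ℝ (y - x)).integrable_comp hiD)
    have hp : (∫ z in S, D z) (y - x) = ∫ z in S, D z (y - x) :=
      ContinuousLinearMap.integral_apply hiD _
    have hkey : obsC n * (w y - w x - ((obsC n)⁻¹ • ∫ z in S, D z) (y - x)) =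
        ∫ z in S, (w z * obsK y r z - w z * obsK x r z - D z (y - x)) := by
      have hs1 : ∫ z in S, (w z * obsK y r z - w z * obsK x r z - D z (y - x)) =
          (∫ z in S, (w z * obsK y r z - w z * obsK x r z)) - ∫ z in S, D z (y - x) :=
        integral_sub ((hi y).sub (hi x)) hiDy
      rw [hs1, integral_sub (hi y) (hi x), hmS y hy,
        hmS x (mem_closedBall_self hr.le), ← hp]
      simp only [ContinuousLinearMap.smul_apply, smul_eq_mul]
      field_simp
    have hbound : ‖∫ z in S, (w z * obsK y r z - w z * obsK x r z - D z (y - x))‖ ≤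
        (A * ((r ^ n)⁻¹ * (B * (r⁻¹ * ‖y - x‖) ^ 2))) * volume.real S := by
      refine norm_setIntegral_le_of_norm_le_const hSfin ?_
      intro z hz
      have hAz := hA z hz
      have h2 := hB2 (r⁻¹ • (z - x)) (r⁻¹ • (z - y))
      have h3 : r⁻¹ • (z - y) - r⁻¹ • (z - x) = (-r⁻¹) • (y - x) := by
        rw [← smul_sub, neg_smul, ← smul_neg]; congr 1; abel
      rw [h3, norm_smul (-r⁻¹), norm_neg, Real.norm_of_nonneg (r := r⁻¹) (by positivity), map_smul,
        smul_eq_mul] at h2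
      have h4 : w z * obsK y r z - w z * obsK x r z - D z (y - x) = w z * ((r ^ n)⁻¹ *
          (obsH (‖r⁻¹ • (z - y)‖ ^ 2) - obsH (‖r⁻¹ • (z - x)‖ ^ 2) - -r⁻¹ *
            fderiv ℝ (fun z : EuclideanSpace ℝ (Fin n) => obsH (‖z‖ ^ 2)) (r⁻¹ • (z - x))
              (y - x))) := by
        rw [obsK_eq y hr, obsK_eq x hr, hD]
        simp only [ContinuousLinearMap.smul_apply, smul_eq_mul]
        ring
      rw [h4, norm_mul, norm_mul, Real.norm_of_nonneg (r := (r ^ n)⁻¹) (by positivity)]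
      rw [← Real.norm_eq_abs] at hAz h2
      gcongr
    rw [← hkey, norm_mul, Real.norm_of_nonneg hC.le, Real.norm_eq_abs, hvol] at hbound
    refine le_of_mul_le_mul_left (hbound.trans (le_of_eq ?_)) hC
    field_simp

lemma obs_C11 {E : Type*} [NormedAddCommGroup E] [InnerProductSpace ℝ E] [CompleteSpace E]
    {v : E → ℝ} {a : E} {ρ M : ℝ} (hρ : 0 < ρ) (hM : 0 ≤ M)
    (h : ∀ x ∈ ball a ρ, ∃ p : E →L[ℝ] ℝ, ∀ y ∈ ball a ρ,
      |v y - v x - p (y - x)| ≤ M * ‖y - x‖ ^ 2) :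
    DifferentiableAt ℝ v a ∧ LipschitzOnWith (Real.toNNReal (6 * M)) (gradient v)
      (ball a (ρ / 3)) := by
  have hder : ∀ x ∈ ball a ρ, ∀ p : E →L[ℝ] ℝ, (∀ y ∈ ball a ρ,
      |v y - v x - p (y - x)| ≤ M * ‖y - x‖ ^ 2) → HasFDerivAt v p x := by
    intro x hx p hp
    rw [hasFDerivAt_iff_isLittleO]
    have h1 : (fun y => v y - v x - p (y - x)) =O[𝓝 x] fun y => ‖y - x‖ ^ 2 := by
      refine Asymptotics.IsBigO.of_bound M ?_
      filter_upwards [isOpen_ball.mem_nhds hx] with y hy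
      rw [Real.norm_eq_abs, norm_pow, norm_norm]
      exact hp y hy
    refine h1.trans_isLittleO ?_
    have h2 : (fun y : E => ‖y - x‖) =o[𝓝 x] fun _ => (1 : ℝ) := by
      rw [Asymptotics.isLittleO_one_iff]
      have : Continuous fun y : E => ‖y - x‖ := by fun_prop
      simpa using this.tendsto x
    have h3 := h2.mul_isBigO (Asymptotics.isBigO_refl (fun y : E => ‖y - x‖) (𝓝 x))
    simp only [one_mul, ← sq] at h3
    exact h3.norm_right.of_norm_right.of_norm_right
  have hg : ∀ x ∈ ball a ρ, DifferentiableAt ℝ v x ∧ ∀ y ∈ ball a ρ,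
      |v y - v x - inner ℝ (gradient v x) (y - x)| ≤ M * ‖y - x‖ ^ 2 := by
    intro x hx
    obtain ⟨p, hp⟩ := h x hx
    have hd := hder x hx p hp
    refine ⟨hd.differentiableAt, fun y hy => ?_⟩
    have : inner ℝ (gradient v x) (y - x) = p (y - x) := by
      rw [gradient, InnerProductSpace.toDual_symm_apply, hd.fderiv]
    rw [this]
    exact hp y hy
  refine ⟨(hg a (mem_ball_self hρ)).1, LipschitzOnWith.of_dist_le_mul ?_⟩
  intro x hx y hy
  rw [Real.coe_toNNReal _ (by positivity), dist_comm, dist_comm x y, dist_eq_norm, dist_eq_norm]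
  set g := gradient v y - gradient v x with hgdef
  by_cases hg0 : g = 0
  · rw [hg0, norm_zero]; positivity
  have hgpos : 0 < ‖g‖ := norm_pos_iff.2 hg0
  by_cases ht0 : y - x = 0
  · have : y = x := sub_eq_zero.1 ht0
    exact absurd (by rw [hgdef, this, sub_self]) hg0
  have htpos : 0 < ‖y - x‖ := norm_pos_iff.2 ht0
  set t := ‖y - x‖ with ht
  set e : E := (t / ‖g‖) • g with he
  have hen : ‖e‖ = t := by
    rw [he, norm_smul, Real.norm_of_nonneg (by positivity)]
    field_simp
  rw [mem_ball, dist_eq_norm] at hx hy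
  have htlt : t < 2 * ρ / 3 := by
    calc t = ‖(y - a) - (x - a)‖ := by rw [ht]; congr 1; abel
      _ ≤ ‖y - a‖ + ‖x - a‖ := norm_sub_le _ _
      _ < _ := by linarith
  have hz : y + e ∈ ball a ρ := by
    rw [mem_ball, dist_eq_norm]
    calc ‖y + e - a‖ = ‖(y - a) + e‖ := by congr 1; abel
      _ ≤ ‖y - a‖ + ‖e‖ := norm_add_le _ _
      _ < ρ := by rw [hen]; linarith
  have hx' : x ∈ ball a ρ := by rw [mem_ball, dist_eq_norm]; linarith
  have hy' : y ∈ ball a ρ := by rw [mem_ball, dist_eq_norm]; linarith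
  have b1 := abs_le.1 ((hg x hx').2 _ hz)
  have b2 := abs_le.1 ((hg x hx').2 _ hy')
  have b3 := abs_le.1 ((hg y hy').2 _ hz)
  have e1 : y + e - x = (y - x) + e := by abel
  have e3 : y + e - y = e := by abel
  rw [e1, inner_add_right] at b1
  rw [e3, hen] at b3
  have hn : ‖(y - x) + e‖ ≤ 2 * t := (norm_add_le _ _).trans (by rw [hen, ← ht]; linarith)
  have hn2 : M * ‖(y - x) + e‖ ^ 2 ≤ M * (2 * t) ^ 2 := by gcongr
  have hin : inner ℝ (gradient v y) e - inner ℝ (gradient v x) e = t * ‖g‖ := by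
    rw [← inner_sub_left, ← hgdef, he, inner_smul_right, real_inner_self_eq_norm_sq]
    field_simp
  rw [← ht] at b2
  have : t * ‖g‖ ≤ t * (6 * M * t) := by nlinarith
  exact le_of_mul_le_mul_left this htpos

lemma obsL_setIntegral {n : ℕ} (x : EuclideanSpace ℝ (Fin n)) {r : ℝ} (hr : 0 < r)
    {S : Set (EuclideanSpace ℝ (Fin n))} (hS : ball x r ⊆ S)
    (f : EuclideanSpace ℝ (Fin n) → ℝ) :
    ∫ y in S, f y * lapSmooth (obsPsi x r) y = ∫ y, f y * lapSmooth (obsPsi x r) y := by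
  refine setIntegral_eq_integral_of_forall_compl_eq_zero fun y hy => ?_
  rw [obsPsi_lap, obsG_zero n (obs_one_le hr (fun h => hy (hS h)))]
  simp

/-- The local second-order expansion of `v`. -/
lemma obs_local {n : ℕ} (hn : n ≠ 0) (Ω : Set (EuclideanSpace ℝ (Fin n))) (hΩopen : IsOpen Ω)
    (φ : EuclideanSpace ℝ (Fin n) → ℝ)
    (hφdiff : ∀ x ∈ Ω, DifferentiableAt ℝ φ x)
    (L : ℝ≥0) (hφlip : LipschitzOnWith L (gradient φ) Ω)
    (v : EuclideanSpace ℝ (Fin n) → ℝ)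
    (hvcont : ContinuousOn v Ω) (hvnonneg : ∀ x ∈ Ω, 0 ≤ v x)
    (hmle : ∀ x R, closedBall x R ⊆ Ω → ∀ r ∈ Ioo 0 R,
      ∫ y, (v y + φ y) * obsK x r y ≤ obsC n * (v x + φ x))
    (hmeq : ∀ x R, closedBall x R ⊆ {x ∈ Ω | 0 < v x} → ∀ r ∈ Ioo 0 R,
      ∫ y, (v y + φ y) * obsK x r y = obsC n * (v x + φ x))
    (a : EuclideanSpace ℝ (Fin n)) (ha : a ∈ Ω) :
    ∃ ρ M : ℝ, 0 < ρ ∧ 0 ≤ M ∧ ∀ x ∈ ball a ρ, ∃ p : EuclideanSpace ℝ (Fin n) →L[ℝ] ℝ,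
      ∀ y ∈ ball a ρ, |v y - v x - p (y - x)| ≤ M * ‖y - x‖ ^ 2 := by
  have hφcont : ContinuousOn φ Ω := fun x hx => (hφdiff x hx).continuousAt.continuousWithinAt
  have hfc : ContinuousOn (fun y => v y + φ y) Ω := hvcont.add hφcont
  have hφT : ∀ x y, closedBall x ‖y - x‖ ⊆ Ω →
      |φ y - φ x - fderiv ℝ φ x (y - x)| ≤ L * ‖y - x‖ ^ 2 := by
    intro x y hxy
    refine obs_taylor L.2 (fun z hz => hφdiff z (hxy hz)) ?_
    intro z hz
    have h := hφlip.norm_sub_le (hxy hz) (hxy (mem_closedBall_self (norm_nonneg _)))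
    rwa [gradient, gradient, ← map_sub, LinearIsometryEquiv.norm_map] at h
  obtain ⟨ε, hε, hεΩ⟩ := Metric.isOpen_iff.1 hΩopen a ha
  set ρ := ε / 9 with hρdef
  have hρ : 0 < ρ := by positivity
  have hΩ8 : closedBall a (8 * ρ) ⊆ Ω := (closedBall_subset_ball (by linarith)).trans hεΩ
  obtain ⟨S, hS⟩ := (isCompact_closedBall a (8 * ρ)).exists_bound_of_continuousOn
    (hvcont.mono hΩ8)
  have hS0 : 0 ≤ S := (norm_nonneg _).trans (hS a (mem_closedBall_self (by positivity)))
  set U : Set (EuclideanSpace ℝ (Fin n)) := ball a (5 * ρ) ∩ v ⁻¹' (Ioi 0) with hU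
  have h5Ω : ball a (5 * ρ) ⊆ Ω :=
    (ball_subset_closedBall.trans (closedBall_subset_closedBall (by linarith))).trans hΩ8
  have hUopen : IsOpen U :=
    (hvcont.mono h5Ω).isOpen_inter_preimage isOpen_ball isOpen_Ioi
  have hUsub : U ⊆ {x ∈ Ω | 0 < v x} := fun z hz => ⟨h5Ω hz.1, hz.2⟩
  have hUne : (Uᶜ).Nonempty := by
    rw [nonempty_compl]
    intro h
    have : NeZero n := ⟨hn⟩
    have hnt : Nontrivial (EuclideanSpace ℝ (Fin n)) := inferInstance
    refine NormedSpace.unbounded_univ ℝ (EuclideanSpace ℝ (Fin n)) ?_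
    rw [← h]
    exact isBounded_ball.subset inter_subset_left
  set d : EuclideanSpace ℝ (Fin n) → ℝ := fun x => min ρ (infDist x Uᶜ) with hd
  have hd0 : ∀ x, 0 ≤ d x := fun x => le_min hρ.le infDist_nonneg
  have hdρ : ∀ x, d x ≤ ρ := fun x => min_le_left _ _
  have hdlip : ∀ x y, d y ≤ d x + ‖y - x‖ := by
    intro x y
    have h := infDist_le_infDist_add_dist (s := Uᶜ) (x := y) (y := x)
    rw [dist_eq_norm] at h
    have h2 := norm_nonneg (y - x)
    simp only [hd]
    rcases le_total ρ (infDist x Uᶜ) with h' | h'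
    · rw [min_eq_left h']
      exact (min_le_left _ _).trans (by linarith)
    · rw [min_eq_right h']
      exact (min_le_right _ _).trans h
  have hdball : ∀ x, ball x (d x) ⊆ U := fun x =>
    (ball_subset_ball (min_le_right _ _)).trans ball_infDist_compl_subset
  set Cg : ℝ := S / ρ ^ 2 + 9 * 6 ^ n * L with hCg
  have hL0 : (0 : ℝ) ≤ L := L.2
  have hCg0 : 0 ≤ Cg := by positivity
  have hgrowth : ∀ x ∈ ball a (2 * ρ), v x ≤ Cg * d x ^ 2 := by
    intro x hx
    have hxa : dist x a < 2 * ρ := hx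
    rcases le_or_gt ρ (infDist x Uᶜ) with h | h
    · have hdx : d x = ρ := min_eq_left h
      rw [hdx]
      have h1 := hS x (mem_closedBall.2 (by linarith))
      have h2 : S = S / ρ ^ 2 * ρ ^ 2 := by field_simp
      have h3 : 0 ≤ 9 * 6 ^ n * (L : ℝ) * ρ ^ 2 := by positivity
      calc v x ≤ S := (le_abs_self _).trans h1
        _ ≤ Cg * ρ ^ 2 := by rw [hCg, add_mul, ← h2]; linarith
    · have hdx : d x = infDist x Uᶜ := min_eq_right h.le
      obtain ⟨x0, hx0U, hx0⟩ := hUopen.isClosed_compl.exists_infDist_eq_dist hUne x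
      rw [hx0] at h hdx
      have hx0a : dist x0 a < 3 * ρ := by
        have := dist_triangle x0 x a
        rw [dist_comm x0 x] at this
        linarith
      have hx0Ω : x0 ∈ Ω := h5Ω (mem_ball.2 (by linarith))
      have hvx0 : v x0 = 0 := by
        refine le_antisymm (not_lt.1 fun h' => hx0U ⟨mem_ball.2 (by linarith), h'⟩)
          (hvnonneg x0 hx0Ω)
      rcases (hd0 x).eq_or_lt with h0 | h0
      · have : x = x0 := dist_eq_zero.1 (by rw [← hdx, ← h0])
        rw [this, hvx0]; positivity
      · have hball4 : closedBall x0 (4 * d x) ⊆ Ω := by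
          refine (closedBall_subset_closedBall' ?_).trans hΩ8
          have := hdρ x
          linarith
        have hball3 : closedBall x0 (3 * d x) ⊆ Ω :=
          (closedBall_subset_closedBall (by linarith)).trans hball4
        have hxx0 : ‖x - x0‖ ≤ d x := by rw [hdx, dist_eq_norm]
        have hg := obs_growth h0 hL0 hxx0 (hfc.mono hball3) (fun y hy => hvnonneg y (hball3 hy))
          hvx0 (hmle x0 (4 * d x) hball4 (3 * d x) ⟨by positivity, by linarith⟩)
          (hmeq x (3 / 4 * d x) ((closedBall_subset_ball (by linarith)).trans
            ((hdball x).trans hUsub)) (d x / 2) ⟨by positivity, by linarith⟩)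
          (fderiv ℝ φ x0) (fun y hy => hφT x0 y
            ((closedBall_subset_closedBall (by rwa [mem_closedBall, dist_eq_norm] at hy)).trans hball3))
        have h3 : 0 ≤ S / ρ ^ 2 * d x ^ 2 := by positivity
        rw [hCg, add_mul]
        linarith
  obtain ⟨C1, hC10, hC1⟩ := obs_harm_taylor n
  set Q : ℝ := C1 * (4 * Cg + L) with hQ
  have hQ0 : 0 ≤ Q := by positivity
  refine ⟨ρ, 16 * Q + L + 41 * Cg, hρ, by positivity, ?_⟩
  intro x hx
  have hxa : dist x a < ρ := hx
  have hx2 : x ∈ ball a (2 * ρ) := mem_ball.2 (by linarith)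
  have hb2 : ball a (2 * ρ) ⊆ Ω := (ball_subset_ball (by linarith)).trans h5Ω
  rcases (hd0 x).eq_or_lt with h0 | h0
  · refine ⟨0, fun y hy => ?_⟩
    have hya : dist y a < ρ := hy
    have hy2 : y ∈ ball a (2 * ρ) := mem_ball.2 (by linarith)
    have hvx : v x = 0 := by
      refine le_antisymm ?_ (hvnonneg x (hb2 hx2))
      have := hgrowth x hx2
      rw [← h0] at this
      simpa using this
    have h1 := hgrowth y hy2
    have h2 := hdlip x y
    rw [← h0, zero_add] at h2
    have h3 : Cg * d y ^ 2 ≤ Cg * ‖y - x‖ ^ 2 := by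
      have := hd0 y
      gcongr
    rw [hvx]
    simp only [ContinuousLinearMap.zero_apply, sub_zero]
    rw [abs_of_nonneg (hvnonneg y (hb2 hy2))]
    have h4 : 0 ≤ (16 * Q + L + 40 * Cg) * ‖y - x‖ ^ 2 := by positivity
    linarith
  · set r := d x / 4 with hr
    have hr0 : 0 < r := by positivity
    have hdr : d x = 4 * r := by rw [hr]; ring
    set p0 := fderiv ℝ φ x with hp0
    have hrρ : 4 * r ≤ ρ := hdr ▸ hdρ x
    have hsub2 : closedBall x (2 * r) ⊆ ball a (2 * ρ) := by
      intro y hy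
      rw [mem_closedBall] at hy
      have := dist_triangle y x a
      exact mem_ball.2 (by linarith)
    have hwc : ContinuousOn (fun y => v y + φ y - ((φ x - p0 x) + p0 y)) (ball a (2 * ρ)) :=
      (hfc.mono hb2).sub (by fun_prop)
    have hsubU : ∀ y ∈ closedBall x r, closedBall y (2 * r) ⊆ ball x (d x) := by
      intro y hy z hz
      rw [mem_closedBall] at hy hz
      have := dist_triangle z y x
      exact mem_ball.2 (by linarith)
    have hUΩ : U ⊆ Ω := fun z hz => h5Ω hz.1
    obtain ⟨p, hpn, hp⟩ := hC1 x r ((4 * Cg + L) * d x ^ 2)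
      (fun y => v y + φ y - ((φ x - p0 x) + p0 y)) hr0 (hwc.mono hsub2) (by
        intro y hy
        have hyx : ‖y - x‖ ≤ 2 * r := by rwa [mem_closedBall, dist_eq_norm] at hy
        have hv0 := hvnonneg y (hb2 (hsub2 hy))
        have hv1 := hgrowth y (hsub2 hy)
        have hv2 := hdlip x y
        have hv3 : Cg * d y ^ 2 ≤ Cg * (2 * d x) ^ 2 := by
          have := hd0 y
          gcongr
          linarith
        have hφ1 := hφT x y ((closedBall_subset_closedBall hyx).trans (hsub2.trans hb2))
        have hφ2 : (L : ℝ) * ‖y - x‖ ^ 2 ≤ L * d x ^ 2 := by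
          gcongr
          linarith
        have e : v y + φ y - ((φ x - p0 x) + p0 y) = v y + (φ y - φ x - p0 (y - x)) := by
          rw [map_sub]; ring
        rw [e]
        refine (abs_add_le _ _).trans ?_
        rw [abs_of_nonneg hv0]
        linarith) (by
        intro y hy
        have hcb : closedBall y r ⊆ Ω := (closedBall_subset_closedBall (by linarith)).trans
          ((hsubU y hy).trans ((hdball x).trans hUΩ))
        rw [obs_mean_sub_affine hr0 (hfc.mono hcb), hmeq y (2 * r)
          ((hsubU y hy).trans ((hdball x).trans hUsub)) r ⟨hr0, by linarith⟩]
        ring)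
    have hpn' : ‖p‖ ≤ 4 * Q * d x := by
      refine hpn.trans (le_of_eq ?_)
      rw [hQ, hdr]; field_simp
    refine ⟨p, fun y hy => ?_⟩
    have hya : dist y a < ρ := hy
    have hy2 : y ∈ ball a (2 * ρ) := mem_ball.2 (by linarith)
    rcases le_or_gt ‖y - x‖ r with hyr | hyr
    · have hyx : y ∈ closedBall x r := by rwa [mem_closedBall, dist_eq_norm]
      have h1 := hp y hyx
      have hφ1 := hφT x y ((closedBall_subset_closedBall (by linarith)).trans (hsub2.trans hb2))
      have e : v y - v x - p (y - x) = ((v y + φ y - ((φ x - p0 x) + p0 y)) -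
          (v x + φ x - ((φ x - p0 x) + p0 x)) - p (y - x)) - (φ y - φ x - p0 (y - x)) := by
        rw [map_sub p0]; ring
      have e2 : C1 * ((4 * Cg + L) * d x ^ 2) / r ^ 2 = 16 * Q := by
        rw [hQ, hdr]; field_simp; ring
      rw [e2] at h1
      rw [e]
      refine (abs_sub _ _).trans ?_
      have h4 : 0 ≤ 41 * Cg * ‖y - x‖ ^ 2 := by positivity
      linarith
    · set t := ‖y - x‖ with ht
      have ht0 : 0 ≤ t := norm_nonneg _
      have hdt : d x ≤ 4 * t := by linarith
      have g1 := hgrowth x hx2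
      have g2 := hgrowth y hy2
      have g3 := hdlip x y
      have n1 := hvnonneg x (hb2 hx2)
      have n2 := hvnonneg y (hb2 hy2)
      have g1' : Cg * d x ^ 2 ≤ Cg * (4 * t) ^ 2 := by gcongr
      have g2' : Cg * d y ^ 2 ≤ Cg * (5 * t) ^ 2 := by
        have := hd0 y
        gcongr
        linarith
      have h5 : |p (y - x)| ≤ 4 * Q * (4 * t) * t := by
        calc |p (y - x)| ≤ ‖p‖ * ‖y - x‖ := p.le_opNorm _
          _ ≤ (4 * Q * (4 * t)) * ‖y - x‖ := by
            gcongr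
            exact hpn'.trans (by gcongr)
      have h6 := abs_le.1 h5
      have h7 : 0 ≤ (L : ℝ) * t ^ 2 := by positivity
      have h8 : 0 ≤ Cg * t ^ 2 := by positivity
      rw [abs_le]
      constructor <;> linarith

/-- Optimal C^{1,1} regularity: if `φ ∈ C^{1,1}(Ω)` and `v ≥ 0` is
continuous on the open set `Ω` with `u := v + φ` distributionally superharmonic
in `Ω` and distributionally harmonic in `{v > 0} ∩ Ω`, then `v ∈ C^{1,1}_loc(Ω)`:
`v` is differentiable on `Ω` and `∇v` is Lipschitz on every compact subset of `Ω`. -/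
theorem obstacle_solution_C11_regularity
    {n : ℕ} (Ω : Set (EuclideanSpace ℝ (Fin n))) (hΩopen : IsOpen Ω)
    (φ : EuclideanSpace ℝ (Fin n) → ℝ)
    (hφdiff : ∀ x ∈ Ω, DifferentiableAt ℝ φ x)
    (L : ℝ≥0) (hφlip : LipschitzOnWith L (gradient φ) Ω)
    (v : EuclideanSpace ℝ (Fin n) → ℝ)
    (hvcont : ContinuousOn v Ω) (hvnonneg : ∀ x ∈ Ω, 0 ≤ v x)
    (hsuper : ∀ ψ : EuclideanSpace ℝ (Fin n) → ℝ,
      ContDiff ℝ (⊤ : ℕ∞) ψ → HasCompactSupport ψ → tsupport ψ ⊆ Ω →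
      (∀ x, 0 ≤ ψ x) →
      ∫ x in Ω, (v x + φ x) * lapSmooth ψ x ≤ 0)
    (hharm : ∀ ψ : EuclideanSpace ℝ (Fin n) → ℝ,
      ContDiff ℝ (⊤ : ℕ∞) ψ → HasCompactSupport ψ →
      tsupport ψ ⊆ {x ∈ Ω | 0 < v x} →
      ∫ x in Ω, (v x + φ x) * lapSmooth ψ x = 0) :
    (∀ x ∈ Ω, DifferentiableAt ℝ v x) ∧
    ∀ K : Set (EuclideanSpace ℝ (Fin n)), K ⊆ Ω → IsCompact K →
      ∃ L' : ℝ≥0, LipschitzOnWith L' (gradient v) K := by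
  rcases eq_or_ne n 0 with hn | hn
  · subst hn
    refine ⟨fun x _ => (hasFDerivAt_of_subsingleton v x).differentiableAt, fun K _ _ => ⟨0, ?_⟩⟩
    intro x _ y _
    rw [Subsingleton.elim x y]
    simp
  have hφcont : ContinuousOn φ Ω := fun x hx => (hφdiff x hx).continuousAt.continuousWithinAt
  have hfc : ContinuousOn (fun y => v y + φ y) Ω := hvcont.add hφcont
  have hmle : ∀ x R, closedBall x R ⊆ Ω → ∀ r ∈ Ioo 0 R,
      ∫ y, (v y + φ y) * obsK x r y ≤ obsC n * (v x + φ x) := by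
    intro x R hR r hr
    refine obs_mean_le (hfc.mono hR) (fun s hs => ?_) hr
    have hsub : closedBall x s ⊆ closedBall x R := closedBall_subset_closedBall hs.2.le
    rw [obsL_setIntegral x hs.1 (ball_subset_closedBall.trans hsub) (fun y => v y + φ y),
      ← obsL_setIntegral x hs.1 (ball_subset_closedBall.trans (hsub.trans hR))
        (fun y => v y + φ y)]
    exact hsuper _ (obsPsi_contDiff x s) (obsPsi_compact x hs.1)
      ((obsPsi_tsupport x hs.1).trans (hsub.trans hR)) (fun y => obsP_nonneg _)
  have hmeq : ∀ x R, closedBall x R ⊆ {x ∈ Ω | 0 < v x} → ∀ r ∈ Ioo 0 R,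
      ∫ y, (v y + φ y) * obsK x r y = obsC n * (v x + φ x) := by
    intro x R hR' r hr
    have hR : closedBall x R ⊆ Ω := fun z hz => (hR' hz).1
    refine obs_mean_eq (hfc.mono hR) (fun s hs => ?_) hr
    have hsub : closedBall x s ⊆ closedBall x R := closedBall_subset_closedBall hs.2.le
    rw [obsL_setIntegral x hs.1 (ball_subset_closedBall.trans hsub) (fun y => v y + φ y),
      ← obsL_setIntegral x hs.1 (ball_subset_closedBall.trans (hsub.trans hR))
        (fun y => v y + φ y)]
    exact hharm _ (obsPsi_contDiff x s) (obsPsi_compact x hs.1)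
      ((obsPsi_tsupport x hs.1).trans (hsub.trans hR'))
  have hmain : ∀ a ∈ Ω, DifferentiableAt ℝ v a ∧ ∃ C : ℝ≥0, ∃ t ∈ 𝓝 a,
      LipschitzOnWith C (gradient v) t := by
    intro a ha
    obtain ⟨ρ, M, hρ, hM, h⟩ := obs_local hn Ω hΩopen φ hφdiff L hφlip v hvcont hvnonneg
      hmle hmeq a ha
    obtain ⟨h1, h2⟩ := obs_C11 hρ hM h
    exact ⟨h1, _, _, ball_mem_nhds a (by positivity), h2⟩
  refine ⟨fun x hx => (hmain x hx).1, fun K hK hKc => ?_⟩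
  refine LocallyLipschitzOn.exists_lipschitzOnWith_of_compact hKc ?_
  intro x hx
  obtain ⟨C, t, ht, hC⟩ := (hmain x (hK hx)).2
  exact ⟨C, t, mem_nhdsWithin_of_mem_nhds ht, hC⟩
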